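/- arXiv:0903.4061 — 6 statements merged into one kernel-verified Lean document; each statement's English description precedes it below -/
import Mathlib

section
/- Let (Ω,ℱ,ℙ) be a probability space with a filtration (ℱ_n)_{n≥1}, let (η_n)_{n≥2} be nonnegative reals with ∑_{n≥2} η_n² < ∞, and let (S_n)_{n≥1}, (H_n)_{n≥2} be real-valued random variables such that each S_n is ℱ_n-measurable, each H_{n+1} is ℱ_{n+1}-measurable with |H_{n+1}| ≤ c₀ almost surely for some constant c₀ < ∞, and S_{n+1} = S_n + η_{n+1} H_{n+1} for all n ≥ 1, with S₁ constant. If there is a constant a < ∞ such that for every n ≥ 1 one has E[H_{n+1} | ℱ_n] ≤ 0 almost surely on the event {S_n ≥ a}, then limsup_{n→∞} S_n < ∞ almost surely. -/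
open MeasureTheory Filter

/-- The squared positive part grows at most quadratically along an increment. -/
lemma sq_max_add_zero_le (x d : ℝ) :
    (max (x + d) 0) ^ 2 ≤ (max x 0) ^ 2 + 2 * max x 0 * d + d ^ 2 := by
  rcases le_total x 0 with h | h <;> rcases le_total (x + d) 0 with h' | h' <;>
    simp only [max_eq_left, max_eq_right, h, h'] <;>
    nlinarith [sq_nonneg d, sq_nonneg (x + d)]

/-- A submartingale bounded above by a constant converges almost surely. -/
lemma MeasureTheory.Submartingale.exists_ae_tendsto_of_le {Ω : Type*} {m0 : MeasurableSpace Ω}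
    {μ : Measure Ω} [IsProbabilityMeasure μ] {ℱ : Filtration ℕ m0} {f : ℕ → Ω → ℝ}
    (hf : Submartingale f ℱ μ) {T : ℝ} (hT : 0 ≤ T) (hfT : ∀ n ω, f n ω ≤ T) :
    ∀ᵐ ω ∂μ, ∃ c, Tendsto (fun n => f n ω) atTop (nhds c) := by
  refine hf.exists_ae_tendsto_of_bdd (R := (2 * T - ∫ ω, f 0 ω ∂μ).toNNReal) fun n => ?_
  rw [eLpNorm_one_eq_lintegral_enorm, ← ofReal_integral_norm_eq_lintegral_enorm (hf.integrable n)]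
  refine ENNReal.ofReal_le_ofReal ?_
  have h0 : ∫ ω, f 0 ω ∂μ ≤ ∫ ω, f n ω ∂μ := by
    simpa using hf.setIntegral_le (Nat.zero_le n) MeasurableSet.univ
  calc ∫ ω, ‖f n ω‖ ∂μ ≤ ∫ ω, (2 * T - f n ω) ∂μ := by
        refine integral_mono (hf.integrable n).norm
          ((integrable_const _).sub (hf.integrable n)) fun ω => ?_
        have := hfT n ω
        exact abs_le.2 ⟨by linarith, by linarith⟩
    _ = 2 * T - ∫ ω, f n ω ∂μ := by
        rw [integral_sub (integrable_const _) (hf.integrable n)]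
        simp
    _ ≤ _ := by linarith

/-- Part (i) of the general stability theorem: a stochastic-approximation-type
recursion `S (n+1) = S n + η (n+1) * H (n+1)` with bounded increments,
square-summable step sizes, and nonpositive conditional drift above a level `a`,
has `limsup S_n < ∞` almost surely. -/
theorem stability_part_i
    {Ω : Type*} {m0 : MeasurableSpace Ω} (μ : Measure Ω) [IsProbabilityMeasure μ]
    (ℱ : Filtration ℕ m0)
    (η : ℕ → ℝ) (hη_nonneg : ∀ n, 2 ≤ n → 0 ≤ η n)
    (hη_sq : Summable (fun n => η n ^ 2))
    (S H : ℕ → Ω → ℝ)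
    (hS_meas : ∀ n, 1 ≤ n → StronglyMeasurable[ℱ n] (S n))
    (hH_meas : ∀ n, 1 ≤ n → StronglyMeasurable[ℱ (n + 1)] (H (n + 1)))
    (c₀ : ℝ) (hc₀ : 0 ≤ c₀)
    (hH_bdd : ∀ n, 1 ≤ n → ∀ᵐ ω ∂μ, |H (n + 1) ω| ≤ c₀)
    (hrec : ∀ n, 1 ≤ n → ∀ ω, S (n + 1) ω = S n ω + η (n + 1) * H (n + 1) ω)
    (s₁ : ℝ) (hS1 : ∀ ω, S 1 ω = s₁)
    (a : ℝ)
    (hdrift : ∀ n, 1 ≤ n → ∀ᵐ ω ∂μ, a ≤ S n ω → (μ[H (n + 1) | ℱ n]) ω ≤ 0) :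
    ∀ᵐ ω ∂μ, Filter.limsup (fun n => ((S n ω : ℝ) : EReal)) atTop < ⊤ := by
  have hS_bdd : ∀ n, 1 ≤ n → ∃ B, ∀ᵐ ω ∂μ, |S n ω| ≤ B := by
    intro n hn
    induction n, hn using Nat.le_induction with
    | base => exact ⟨|s₁|, .of_forall fun ω => by rw [hS1]⟩
    | succ n hn ih =>
      obtain ⟨B, hB⟩ := ih
      refine ⟨B + |η (n + 1)| * c₀, ?_⟩
      filter_upwards [hB, hH_bdd n hn] with ω h1 h2
      rw [hrec n hn]
      refine (abs_add_le _ _).trans (add_le_add h1 ?_)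
      rw [abs_mul]
      gcongr
  let 𝒢 : Filtration ℕ m0 :=
    ⟨fun n => ℱ (n + 1), fun i j h => ℱ.mono (Nat.succ_le_succ h), fun n => ℱ.le (n + 1)⟩
  let r : ℕ → ℝ := fun n => ∑ k ∈ Finset.range n, c₀ ^ 2 * η (k + 2) ^ 2
  let P : ℕ → Ω → ℝ := fun n ω => max (S (n + 1) ω - a) 0
  let f : ℕ → Ω → ℝ := fun n ω => r n - P n ω ^ 2
  have hr_sum : Summable fun k => c₀ ^ 2 * η (k + 2) ^ 2 :=
    ((summable_nat_add_iff 2).2 hη_sq).mul_left _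
  have hr_le : ∀ n, r n ≤ ∑' k, c₀ ^ 2 * η (k + 2) ^ 2 := fun n =>
    hr_sum.sum_le_tsum _ fun k _ => by positivity
  have hP_nonneg : ∀ n ω, 0 ≤ P n ω := fun n ω => le_max_right _ _
  have hP_meas : ∀ n, StronglyMeasurable[ℱ (n + 1)] (P n) := fun n =>
    (by fun_prop : Continuous fun x : ℝ => max (x - a) 0).comp_stronglyMeasurable
      (hS_meas (n + 1) (by omega))
  have hP_bdd : ∀ n, ∃ B, ∀ᵐ ω ∂μ, ‖P n ω‖ ≤ B := by
    intro n
    obtain ⟨B, hB⟩ := hS_bdd (n + 1) (by omega)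
    refine ⟨B + |a|, ?_⟩
    filter_upwards [hB] with ω h
    rw [Real.norm_of_nonneg (hP_nonneg n ω)]
    have := neg_abs_le a
    exact max_le (by linarith [le_abs_self (S (n + 1) ω)])
      (add_nonneg ((abs_nonneg _).trans h) (abs_nonneg _))
  have hf_meas : ∀ n, StronglyMeasurable[ℱ (n + 1)] (f n) := fun n =>
    stronglyMeasurable_const.sub ((hP_meas n).pow 2)
  have hf_int : ∀ n, Integrable (f n) μ := by
    intro n
    obtain ⟨B, hB⟩ := hP_bdd n
    refine (integrable_const _).sub
      (.of_bound (((hP_meas n).mono (ℱ.le _)).pow 2).aestronglyMeasurable (B ^ 2) ?_)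
    filter_upwards [hB] with ω h
    rw [norm_pow]
    gcongr
  have hf_sub : Submartingale f 𝒢 μ := by
    refine submartingale_nat hf_meas hf_int fun n => ?_
    have hn : 1 ≤ n + 1 := by omega
    have hη : 0 ≤ η (n + 2) := hη_nonneg _ (by omega)
    have hH_int : Integrable (H (n + 2)) μ :=
      .of_bound ((hH_meas (n + 1) hn).mono (ℱ.le _)).aestronglyMeasurable c₀ (hH_bdd (n + 1) hn)
    let g : Ω → ℝ := fun ω => 2 * η (n + 2) * P n ω
    have hg_meas : StronglyMeasurable[ℱ (n + 1)] g := (hP_meas n).const_mul _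
    have hgH_int : Integrable (g * H (n + 2)) μ := by
      obtain ⟨B, hB⟩ := hP_bdd n
      refine hH_int.bdd_mul (hg_meas.mono (ℱ.le _)).aestronglyMeasurable
        (c := 2 * η (n + 2) * B) ?_
      filter_upwards [hB] with ω h
      rw [norm_mul, Real.norm_of_nonneg (by positivity : 0 ≤ 2 * η (n + 2))]
      gcongr
    have hstep : f n - g * H (n + 2) ≤ᵐ[μ] f (n + 1) := by
      filter_upwards [hH_bdd (n + 1) hn] with ω h
      have hsq : (η (n + 2) * H (n + 2) ω) ^ 2 ≤ c₀ ^ 2 * η (n + 2) ^ 2 := by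
        have := sq_le_sq' (abs_le.1 h).1 (abs_le.1 h).2
        rw [mul_pow, mul_comm]
        gcongr
      have hmax := sq_max_add_zero_le (S (n + 1) ω - a) (η (n + 2) * H (n + 2) ω)
      have hrS : r (n + 1) = r n + c₀ ^ 2 * η (n + 2) ^ 2 := Finset.sum_range_succ _ _
      have hPS : P (n + 1) ω = max (S (n + 1) ω - a + η (n + 2) * H (n + 2) ω) 0 := by
        simp only [P]
        rw [hrec (n + 1) hn]
        congr 1
        ring
      simp only [Pi.sub_apply, Pi.mul_apply, f, g, hrS, hPS]
      simp only [P]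
      linarith
    have hmono := condExp_mono (m := ℱ (n + 1)) ((hf_int n).sub hgH_int) (hf_int (n + 1)) hstep
    have hsub := condExp_sub (hf_int n) hgH_int (ℱ (n + 1))
    have hmul := condExp_mul_of_stronglyMeasurable_left hg_meas hgH_int hH_int
    have hself := condExp_of_stronglyMeasurable (ℱ.le (n + 1)) (hf_meas n) (hf_int n)
    filter_upwards [hmono, hsub, hmul, hdrift (n + 1) hn] with ω h1 h2 h3 h4
    refine le_trans ?_ h1
    rw [h2, Pi.sub_apply, hself, h3, Pi.mul_apply]
    have : g ω * (μ[H (n + 2) | ℱ (n + 1)]) ω ≤ 0 := by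
      rcases le_or_gt a (S (n + 1) ω) with h | h
      · exact mul_nonpos_of_nonneg_of_nonpos
          (mul_nonneg (by positivity) (hP_nonneg n ω)) (h4 h)
      · have : P n ω = 0 := max_eq_right (by linarith)
        simp [g, this]
    linarith
  have hlim := hf_sub.exists_ae_tendsto_of_le (T := ∑' k, c₀ ^ 2 * η (k + 2) ^ 2)
    (tsum_nonneg fun k => by positivity)
    fun n ω => (sub_le_self _ (sq_nonneg _)).trans (hr_le n)
  filter_upwards [hlim] with ω ⟨c, hc⟩
  obtain ⟨b, hb⟩ := hc.bddBelow_range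
  refine (limsup_le_of_le (a := ((a + 1 + (∑' k, c₀ ^ 2 * η (k + 2) ^ 2 - b) : ℝ) : EReal))
    (by isBoundedDefault) ?_).trans_lt (EReal.coe_lt_top _)
  filter_upwards [eventually_ge_atTop 1] with n hn
  obtain ⟨n, rfl⟩ := Nat.exists_eq_add_of_le' hn
  rw [EReal.coe_le_coe_iff]
  have h1 : b ≤ r n - P n ω ^ 2 := hb ⟨n, rfl⟩
  have h2 : S (n + 1) ω - a ≤ P n ω := le_max_left _ _
  nlinarith [hr_le n, sq_nonneg (P n ω - 1), hP_nonneg n ω]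
end

section
/- Let (Ω,ℱ,ℙ) be a probability space with a filtration (ℱ_n)_{n≥1}, let (η_n)_{n≥2} be nonnegative reals with ∑_{n≥2} η_n² < ∞ and ∑_{n≥2} η_n = ∞, and let (S_n)_{n≥1}, (H_n)_{n≥2} be real-valued random variables such that each S_n is ℱ_n-measurable, each H_{n+1} is ℱ_{n+1}-measurable with |H_{n+1}| ≤ c₀ almost surely for some constant c₀ < ∞, and S_{n+1} = S_n + η_{n+1} H_{n+1} for all n ≥ 1, with S₁ constant. If there are a non-decreasing sequence of constants (a_n)_{n≥1} ⊂ ℝ and a constant b < 0 such that for every n ≥ 1 one has E[H_{n+1} | ℱ_n] ≤ b almost surely on the event {S_n ≥ a_n}, then limsup_{n→∞} (S_n − a_n) ≤ 0 almost surely. -/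
open MeasureTheory Filter Topology

section MartingaleConvergence

variable {Ω : Type*} {m0 : MeasurableSpace Ω} {μ : Measure Ω} [IsProbabilityMeasure μ]

/-- A random variable that is orthogonal to the past is orthogonal to past square-integrable
variables. -/
theorem integral_mul_eq_zero_of_condExp_eq_zero {m : MeasurableSpace Ω} (hm : m ≤ m0)
    {f g : Ω → ℝ} (hf : StronglyMeasurable[m] f) (hf2 : MemLp f 2 μ) (hg2 : MemLp g 2 μ)
    (hg : μ[g | m] =ᵐ[μ] 0) : ∫ ω, f ω * g ω ∂μ = 0 := by
  have hfg : Integrable (f * g) μ := hf2.integrable_mul hg2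
  have h0 : μ[f * g | m] =ᵐ[μ] 0 := by
    filter_upwards [condExp_mul_of_stronglyMeasurable_left hf hfg (hg2.integrable one_le_two), hg]
      with ω h1 h2
    simp [h1, h2]
  calc ∫ ω, f ω * g ω ∂μ = ∫ ω, (μ[f * g | m]) ω ∂μ := (integral_condExp hm).symm
    _ = 0 := by rw [integral_congr_ae h0]; simp

/-- The partial sums of martingale differences with summable second moments converge almost
surely. -/
theorem ae_exists_tendsto_sum_of_summable_integral_sq (ℱ : Filtration ℕ m0) {d : ℕ → Ω → ℝ}
    (hd : ∀ n, StronglyMeasurable[ℱ (n + 1)] (d n)) (hd2 : ∀ n, MemLp (d n) 2 μ)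
    (hd0 : ∀ n, μ[d n | ℱ n] =ᵐ[μ] 0) (hsum : Summable fun n => ∫ ω, d n ω ^ 2 ∂μ) :
    ∀ᵐ ω ∂μ, ∃ c, Tendsto (fun n => ∑ k ∈ Finset.range n, d k ω) atTop (𝓝 c) := by
  set M : ℕ → Ω → ℝ := fun n ω => ∑ k ∈ Finset.range n, d k ω with hM
  have hM_succ : ∀ n, M (n + 1) = M n + d n := fun n => by
    ext ω; simp [hM, Finset.sum_range_succ]
  have hM_meas : ∀ n, StronglyMeasurable[ℱ n] (M n) := fun n =>
    Finset.stronglyMeasurable_fun_sum _ fun k hk =>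
      (hd k).mono (ℱ.mono (Finset.mem_range.1 hk))
  have hM2 : ∀ n, MemLp (M n) 2 μ := fun n => memLp_finsetSum _ fun k _ => hd2 k
  have hmart : Martingale M ℱ μ := by
    refine martingale_of_condExp_sub_eq_zero_nat hM_meas
      (fun n => (hM2 n).integrable one_le_two) fun n => ?_
    rw [hM_succ, add_sub_cancel_left]
    exact hd0 n
  have hsq : ∀ n, ∫ ω, M n ω ^ 2 ∂μ = ∑ k ∈ Finset.range n, ∫ ω, d k ω ^ 2 ∂μ := by
    intro n
    induction n with
    | zero => simp [hM]
    | succ n ih =>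
      have hcross : Integrable (fun ω => M n ω * d n ω) μ := (hM2 n).integrable_mul (hd2 n)
      rw [Finset.sum_range_succ, ← ih, hM_succ]
      calc ∫ ω, (M n + d n) ω ^ 2 ∂μ
          = ∫ ω, (M n ω ^ 2 + 2 * (M n ω * d n ω)) + d n ω ^ 2 ∂μ := by
            congr 1; ext ω; simp only [Pi.add_apply]; ring
        _ = _ := by
            have hsum2 : Integrable (fun ω => M n ω ^ 2 + 2 * (M n ω * d n ω)) μ :=
              (hM2 n).integrable_sq.add (hcross.const_mul 2)
            rw [integral_add hsum2 (hd2 n).integrable_sq,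
              integral_add (hM2 n).integrable_sq (hcross.const_mul 2), integral_const_mul,
              integral_mul_eq_zero_of_condExp_eq_zero (ℱ.le n) (hM_meas n) (hM2 n) (hd2 n) (hd0 n),
              mul_zero, add_zero]
  refine hmart.submartingale.exists_ae_tendsto_of_bdd
    (R := Real.toNNReal ((∑' k, ∫ ω, d k ω ^ 2 ∂μ) + 1)) fun n => ?_
  rw [eLpNorm_one_eq_lintegral_enorm,
    ← ofReal_integral_norm_eq_lintegral_enorm ((hM2 n).integrable one_le_two)]
  refine ENNReal.ofReal_le_ofReal ?_
  calc ∫ ω, ‖M n ω‖ ∂μ ≤ ∫ ω, M n ω ^ 2 + 1 ∂μ := by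
        refine integral_mono ((hM2 n).integrable one_le_two).norm
          ((hM2 n).integrable_sq.add (integrable_const 1)) fun ω => ?_
        simp only [Real.norm_eq_abs]
        nlinarith [sq_abs (M n ω), sq_nonneg (|M n ω| - 1), abs_nonneg (M n ω)]
    _ = (∑ k ∈ Finset.range n, ∫ ω, d k ω ^ 2 ∂μ) + 1 := by
        rw [integral_add (hM2 n).integrable_sq (integrable_const 1), hsq]; simp
    _ ≤ _ := by
        gcongr
        exact hsum.sum_le_tsum _ fun k _ => integral_nonneg fun ω => sq_nonneg _

/-- The centred increments of a bounded adapted sequence, weighted by square-summable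
coefficients, have almost surely convergent partial sums. -/
theorem ae_exists_tendsto_sum_mul_sub_condExp (ℱ : Filtration ℕ m0) {η : ℕ → ℝ}
    (hη : Summable fun n => η n ^ 2) {X : ℕ → Ω → ℝ}
    (hX : ∀ n, StronglyMeasurable[ℱ (n + 1)] (X n)) {c : ℝ}
    (hXc : ∀ n, ∀ᵐ ω ∂μ, |X n ω| ≤ c) :
    ∀ᵐ ω ∂μ, ∃ l, Tendsto
      (fun n => ∑ k ∈ Finset.range n, η k * (X k ω - (μ[X k | ℱ k]) ω)) atTop (𝓝 l) := by
  have hXm : ∀ n, AEStronglyMeasurable (X n) μ := fun n =>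
    ((hX n).mono (ℱ.le _)).aestronglyMeasurable
  have hXint : ∀ n, Integrable (X n) μ := fun n => .of_bound (hXm n) c (hXc n)
  have hd_meas : ∀ n, StronglyMeasurable[ℱ (n + 1)]
      (fun ω => η n * (X n ω - (μ[X n | ℱ n]) ω)) := fun n =>
    ((hX n).sub (stronglyMeasurable_condExp.mono (ℱ.mono n.le_succ))).const_mul _
  have hd_bdd : ∀ n, ∀ᵐ ω ∂μ, |η n * (X n ω - (μ[X n | ℱ n]) ω)| ≤ |η n| * (2 * c) := by
    intro n
    filter_upwards [hXc n, ae_bdd_abs_condExp_of_ae_bdd_abs (m := ℱ n) (hXc n)] with ω h1 h2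
    rw [abs_mul]
    gcongr
    linarith [abs_sub (X n ω) ((μ[X n | ℱ n]) ω)]
  have hd2 : ∀ n, MemLp (fun ω => η n * (X n ω - (μ[X n | ℱ n]) ω)) 2 μ := fun n =>
    .of_bound ((hd_meas n).mono (ℱ.le _)).aestronglyMeasurable _ (hd_bdd n)
  refine ae_exists_tendsto_sum_of_summable_integral_sq ℱ hd_meas hd2 (fun n => ?_) ?_
  · have h1 : μ[fun ω => η n * (X n ω - (μ[X n | ℱ n]) ω) | ℱ n]
        =ᵐ[μ] η n • μ[X n - μ[X n | ℱ n] | ℱ n] := condExp_smul (η n) (X n - μ[X n | ℱ n]) (ℱ n)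
    have h2 := condExp_sub (hXint n) (integrable_condExp (m := ℱ n) (f := X n)) (ℱ n)
    rw [condExp_of_stronglyMeasurable (ℱ.le n) stronglyMeasurable_condExp integrable_condExp,
      sub_self] at h2
    filter_upwards [h1, h2] with ω h1 h2
    simp [h1, h2]
  · refine .of_nonneg_of_le (fun n => integral_nonneg fun ω => sq_nonneg _) (fun n => ?_)
      (hη.mul_right ((2 * c) ^ 2))
    calc ∫ ω, (η n * (X n ω - (μ[X n | ℱ n]) ω)) ^ 2 ∂μ
        ≤ ∫ _, η n ^ 2 * (2 * c) ^ 2 ∂μ := by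
          refine integral_mono_ae (hd2 n).integrable_sq (integrable_const _) ?_
          filter_upwards [hd_bdd n] with ω h
          rw [← sq_abs, ← sq_abs (η n), ← mul_pow]
          gcongr
      _ = η n ^ 2 * (2 * c) ^ 2 := by simp

end MartingaleConvergence

/-- A real recursion with vanishing, non-summable steps, convergent noise, and negative drift above
a nondecreasing barrier eventually stays below every level above the barrier. -/
theorem eventually_le_add_of_drift_of_cauchySeq {η s a h D M : ℕ → ℝ} {b c ε : ℝ}
    (hη : ∀ n, 0 ≤ η n) (hη0 : Tendsto η atTop (𝓝 0))
    (hη_div : Tendsto (fun n => ∑ k ∈ Finset.range n, η k) atTop atTop)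
    (hs : ∀ n, s (n + 1) = s n + η n * h n) (hh : ∀ n, h n ≤ c)
    (ha : Monotone a) (hb : b < 0) (hD : ∀ n, a n ≤ s n → D n ≤ b)
    (hM : ∀ n, M (n + 1) = M n + η n * (h n - D n)) (hMc : CauchySeq M) (hε : 0 < ε) :
    ∀ᶠ n in atTop, s n ≤ a n + ε := by
  have hsmall : ∀ᶠ n in atTop, η n * c < ε / 2 := by
    have := hη0.mul_const c
    rw [zero_mul] at this
    exact this.eventually_lt_const (half_pos hε)
  obtain ⟨N₁, hN₁⟩ := eventually_atTop.1 hsmall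
  obtain ⟨N₂, hN₂⟩ := Metric.cauchySeq_iff.1 hMc (ε / 2) (half_pos hε)
  set N := max N₁ N₂
  have hstep : ∀ n, s (n + 1) = s n + η n * D n + (M (n + 1) - M n) := fun n => by
    rw [hs, hM]; ring
  have hMdist : ∀ m ≥ N, ∀ n ≥ N, M n - M m < ε / 2 := fun m hm n hn =>
    (le_abs_self _).trans_lt (hN₂ n (le_of_max_le_right hn) m (le_of_max_le_right hm))
  have hdown : ∀ n, a n ≤ s n → s (n + 1) ≤ s n + b * η n + (M (n + 1) - M n) := fun n hn => by
    rw [hstep]; nlinarith [mul_le_mul_of_nonneg_left (hD n hn) (hη n)]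
  obtain ⟨n₀, hn₀, hlt⟩ : ∃ n ≥ N, s n < a n := by
    by_contra! hcon
    have hbound : ∀ n ≥ N, s n ≤ s N + b * (∑ k ∈ Finset.range n, η k
        - ∑ k ∈ Finset.range N, η k) + (M n - M N) := by
      intro n hn
      induction n, hn using Nat.le_induction with
      | base => simp
      | succ n hn ih =>
        rw [Finset.sum_range_succ]
        linarith [hdown n (hcon n hn)]
    have hbot := (hη_div.const_mul_atTop_of_neg hb).eventually_lt_atBot
      (a N - s N - ε / 2 + b * ∑ k ∈ Finset.range N, η k)
    obtain ⟨n, hn, hnN⟩ := (hbot.and (eventually_ge_atTop N)).exists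
    linarith [hbound n hnN, hcon n hnN, ha hnN, hMdist N le_rfl n hnN]
  have hinv : ∀ n ≥ n₀, ∃ m ≥ N, s n ≤ a n + ε / 2 + (M n - M m) := by
    intro n hn
    induction n, hn using Nat.le_induction with
    | base => exact ⟨n₀, hn₀, by linarith⟩
    | succ n hn ih =>
      have han := ha n.le_succ
      rcases lt_or_ge (s n) (a n) with hlt | hge
      · refine ⟨n + 1, by omega, ?_⟩
        have h1 := hN₁ n (le_of_max_le_left (hn₀.trans hn))
        have h2 := mul_le_mul_of_nonneg_left (hh n) (hη n)
        rw [hs]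
        linarith
      · obtain ⟨m, hm, hle⟩ := ih
        refine ⟨m, hm, ?_⟩
        linarith [hdown n hge, mul_nonpos_of_nonpos_of_nonneg hb.le (hη n)]
  filter_upwards [eventually_ge_atTop n₀] with n hn
  obtain ⟨m, hm, hle⟩ := hinv n hn
  linarith [hMdist m hm n (hn₀.trans hn)]

/-- Part (ii) of the general stability theorem: with step sizes that are
square-summable but not summable, and conditional drift at most `b < 0`
whenever `S n ≥ a n` (a nondecreasing sequence of levels),
`limsup (S n − a n) ≤ 0` almost surely. -/
theorem stability_part_ii
    {Ω : Type*} {m0 : MeasurableSpace Ω} (μ : Measure Ω) [IsProbabilityMeasure μ]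
    (ℱ : Filtration ℕ m0)
    (η : ℕ → ℝ) (hη_nonneg : ∀ n, 2 ≤ n → 0 ≤ η n)
    (hη_sq : Summable (fun n => η n ^ 2))
    (hη_div : ¬ Summable (fun n => η n))
    (S H : ℕ → Ω → ℝ)
    (hS_meas : ∀ n, 1 ≤ n → StronglyMeasurable[ℱ n] (S n))
    (hH_meas : ∀ n, 1 ≤ n → StronglyMeasurable[ℱ (n + 1)] (H (n + 1)))
    (c₀ : ℝ) (hc₀ : 0 ≤ c₀)
    (hH_bdd : ∀ n, 1 ≤ n → ∀ᵐ ω ∂μ, |H (n + 1) ω| ≤ c₀)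
    (hrec : ∀ n, 1 ≤ n → ∀ ω, S (n + 1) ω = S n ω + η (n + 1) * H (n + 1) ω)
    (s₁ : ℝ) (hS1 : ∀ ω, S 1 ω = s₁)
    (a : ℕ → ℝ) (ha : Monotone a)
    (b : ℝ) (hb : b < 0)
    (hdrift : ∀ n, 1 ≤ n → ∀ᵐ ω ∂μ, a n ≤ S n ω → (μ[H (n + 1) | ℱ n]) ω ≤ b) :
    ∀ᵐ ω ∂μ, Filter.limsup (fun n => ((S n ω - a n : ℝ) : EReal)) atTop ≤ 0 := by
  let 𝒢 : Filtration ℕ m0 :=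
    ⟨fun n => ℱ (n + 1), fun _ _ h => ℱ.mono (Nat.succ_le_succ h), fun n => ℱ.le (n + 1)⟩
  have hη_sq' : Summable fun n => η (n + 2) ^ 2 :=
    (summable_nat_add_iff (f := fun n => η n ^ 2) 2).2 hη_sq
  have hη_nonneg' : ∀ n, 0 ≤ η (n + 2) := fun n => hη_nonneg _ (by omega)
  have hη_zero : Tendsto (fun n => η (n + 2)) atTop (𝓝 0) := by
    simpa [Real.sqrt_sq (hη_nonneg' _)] using hη_sq'.tendsto_atTop_zero.sqrt
  have hη_div' : Tendsto (fun n => ∑ k ∈ Finset.range n, η (k + 2)) atTop atTop :=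
    (not_summable_iff_tendsto_nat_atTop_of_nonneg hη_nonneg').1
      fun h => hη_div ((summable_nat_add_iff 2).1 h)
  have hnoise := ae_exists_tendsto_sum_mul_sub_condExp (μ := μ) 𝒢 hη_sq'
    (X := fun n => H (n + 2)) (fun n => hH_meas (n + 1) (by omega))
    (fun n => hH_bdd (n + 1) (by omega))
  have hbdd : ∀ᵐ ω ∂μ, ∀ n, |H (n + 2) ω| ≤ c₀ :=
    ae_all_iff.2 fun n => hH_bdd (n + 1) (by omega)
  have hdrift' : ∀ᵐ ω ∂μ, ∀ n, a (n + 1) ≤ S (n + 1) ω → (μ[H (n + 2) | ℱ (n + 1)]) ω ≤ b :=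
    ae_all_iff.2 fun n => hdrift (n + 1) (by omega)
  filter_upwards [hnoise, hbdd, hdrift'] with ω ⟨l, hl⟩ hω_bdd hω_drift
  refine EReal.le_of_forall_lt_iff_le.1 fun ε hε => ?_
  have hε' : 0 < ε := EReal.coe_pos.1 hε
  have hev : ∀ᶠ n in atTop, S (n + 1) ω ≤ a (n + 1) + ε :=
    eventually_le_add_of_drift_of_cauchySeq (s := fun n => S (n + 1) ω)
      (a := fun n => a (n + 1)) (h := fun n => H (n + 2) ω)
      (D := fun n => (μ[H (n + 2) | ℱ (n + 1)]) ω) hη_nonneg' hη_zero hη_div'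
      (fun n => hrec (n + 1) (by omega) ω) (fun n => (le_abs_self _).trans (hω_bdd n))
      (fun _ _ h => ha (Nat.succ_le_succ h)) hb hω_drift
      (fun n => Finset.sum_range_succ _ n) hl.cauchySeq hε'
  refine limsup_le_of_le (by isBoundedDefault) ?_
  obtain ⟨n₀, hn₀⟩ := eventually_atTop.1 hev
  filter_upwards [eventually_ge_atTop (n₀ + 1)] with n hn
  obtain ⟨k, rfl⟩ : ∃ k, n = k + 1 := ⟨n - 1, by omega⟩
  exact EReal.coe_le_coe_iff.2 (by linarith [hn₀ k (by omega)])
end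

section
/- Let π be a probability density on ℝ^d whose support 𝒳 := {x : π(x) > 0} is compact, let q be any probability density on ℝ^d, and let φ : ℝ → (0,∞) be increasing and surjective. Then for every α* > 0 there exists a ∈ ℝ such that acc(x,s) ≤ α*/2 for every x ∈ 𝒳 and every s ≥ a; equivalently, acc(x,s) − α* ≤ −α*/2 < 0 whenever s ≥ a. -/
open MeasureTheory Set

/-- The scaled proposal density `q_s(z) = φ(s)^{-d} q(φ(s)⁻¹ z)`. -/
noncomputable def scaledProp (d : ℕ) (q : EuclideanSpace ℝ (Fin d) → ℝ) (φ : ℝ → ℝ)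
    (s : ℝ) (z : EuclideanSpace ℝ (Fin d)) : ℝ :=
  (φ s) ^ (-(d : ℤ)) * q ((φ s)⁻¹ • z)

/-- The expected acceptance rate `acc(x,s) = ∫_{𝒳} min{1, π(y)/π(x)} q_s(x−y) dy`,
where `𝒳 = {z : π(z) > 0}` is the support of `π`. -/
noncomputable def accRate (d : ℕ) (π q : EuclideanSpace ℝ (Fin d) → ℝ) (φ : ℝ → ℝ)
    (x : EuclideanSpace ℝ (Fin d)) (s : ℝ) : ℝ :=
  ∫ y in {z | 0 < π z}, min 1 (π y / π x) * scaledProp d q φ s (x - y)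

/-- If singletons are null, the mass of an integrable function on small closed balls is small. -/
theorem exists_pos_setIntegral_closedBall_le {E : Type*} [MetricSpace E] [MeasurableSpace E]
    [OpensMeasurableSpace E] {μ : Measure E} [NullSingletonClass μ] {f : E → ℝ}
    (hf : Integrable f μ) (c : E) {ε : ℝ} (hε : 0 < ε) :
    ∃ δ : ℝ, 0 < δ ∧ ∫ z in Metric.closedBall c δ, f z ∂μ ≤ ε := by
  have hanti : Antitone fun n : ℕ ↦ Metric.closedBall c (1 / ((n : ℝ) + 1)) := fun m n hmn ↦
    Metric.closedBall_subset_closedBall (Nat.one_div_le_one_div hmn)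
  have hinter : ⋂ n : ℕ, Metric.closedBall c (1 / ((n : ℝ) + 1)) = {c} := by
    ext z
    simp only [mem_iInter, Metric.mem_closedBall, mem_singleton_iff]
    refine ⟨fun h ↦ dist_le_zero.1 ?_, ?_⟩
    · exact ge_of_tendsto' tendsto_one_div_add_atTop_nhds_zero_nat h
    · rintro rfl n
      rw [dist_self]
      positivity
  have ht := tendsto_setIntegral_of_antitone (μ := μ) (f := f)
    (fun n : ℕ ↦ Metric.isClosed_closedBall.measurableSet) hanti ⟨0, hf.integrableOn⟩
  rw [hinter, Measure.restrict_singleton, measure_singleton, zero_smul,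
    integral_zero_measure] at ht
  obtain ⟨n, hn⟩ := (ht.eventually_le_const hε).exists
  exact ⟨1 / ((n : ℝ) + 1), by positivity, hn⟩

section ScaledProposal

variable {d : ℕ} {q : EuclideanSpace ℝ (Fin d) → ℝ} {φ : ℝ → ℝ} {s : ℝ}

theorem scaledProp_nonneg (hq : ∀ z, 0 ≤ q z) (hs : 0 < φ s) (z : EuclideanSpace ℝ (Fin d)) :
    0 ≤ scaledProp d q φ s z :=
  mul_nonneg (zpow_nonneg hs.le _) (hq _)

theorem integrable_scaledProp (hq : Integrable q) (hs : 0 < φ s) :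
    Integrable (scaledProp d q φ s) :=
  (hq.comp_smul (inv_ne_zero hs.ne')).const_mul _

/-- Rescaling turns the mass of `q_s` in the ball of radius `r` into the mass of `q` in the ball of
radius `r / φ s`. -/
theorem setIntegral_closedBall_scaledProp (hs : 0 < φ s) (r : ℝ) :
    ∫ z in Metric.closedBall 0 r, scaledProp d q φ s z =
      ∫ z in Metric.closedBall 0 (r / φ s), q z := by
  have hind : (Metric.closedBall 0 r).indicator (scaledProp d q φ s) = fun z ↦
      (φ s) ^ (-(d : ℤ)) * (Metric.closedBall 0 (r / φ s)).indicator q ((φ s)⁻¹ • z) := by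
    ext z
    have hmem : (φ s)⁻¹ • z ∈ Metric.closedBall 0 (r / φ s) ↔ z ∈ Metric.closedBall 0 r := by
      rw [mem_closedBall_zero_iff, mem_closedBall_zero_iff, norm_smul, norm_inv,
        Real.norm_of_nonneg hs.le, inv_mul_eq_div, div_le_div_iff_of_pos_right hs]
    by_cases hz : z ∈ Metric.closedBall 0 r
    · rw [indicator_of_mem hz, indicator_of_mem (hmem.2 hz), scaledProp]
    · rw [indicator_of_notMem hz, indicator_of_notMem (mt hmem.1 hz), mul_zero]
  rw [← integral_indicator Metric.isClosed_closedBall.measurableSet, hind, integral_const_mul,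
    Measure.integral_comp_smul, finrank_euclideanSpace_fin,
    integral_indicator Metric.isClosed_closedBall.measurableSet, smul_eq_mul, inv_pow, inv_inv,
    abs_of_pos (pow_pos hs d), ← mul_assoc, zpow_neg, zpow_natCast,
    inv_mul_cancel₀ (pow_pos hs d).ne', one_mul]

/-- If the support of `π` lies within distance `r` of `x`, the acceptance rate at `x` is at most the
mass of `q` in the ball of radius `r / φ s`. -/
theorem accRate_le_setIntegral_closedBall {π : EuclideanSpace ℝ (Fin d) → ℝ}
    (hπ_meas : Measurable π) (hπ_nonneg : ∀ x, 0 ≤ π x)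
    (hq : Integrable q) (hq_nonneg : ∀ z, 0 ≤ q z) (hs : 0 < φ s)
    {x : EuclideanSpace ℝ (Fin d)} {r : ℝ} (hr : ∀ y, 0 < π y → dist x y ≤ r) :
    accRate d π q φ x s ≤ ∫ z in Metric.closedBall 0 (r / φ s), q z := by
  have hX : MeasurableSet {z | 0 < π z} := measurableSet_lt measurable_const hπ_meas
  have hint := integrable_scaledProp hq hs
  have hball : MeasurableSet (Metric.closedBall (0 : EuclideanSpace ℝ (Fin d)) r) :=
    Metric.isClosed_closedBall.measurableSet
  rw [← setIntegral_closedBall_scaledProp hs, ← integral_indicator hball,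
    ← integral_sub_left_eq_self _ volume x, accRate, ← integral_indicator hX]
  refine integral_mono_of_nonneg (.of_forall fun y ↦ ?_)
    ((hint.indicator hball).comp_sub_left x) (.of_forall fun y ↦ ?_)
  · exact indicator_nonneg (fun z _ ↦ mul_nonneg
      (le_min zero_le_one (div_nonneg (hπ_nonneg z) (hπ_nonneg x)))
      (scaledProp_nonneg hq_nonneg hs _)) y
  · refine indicator_le' (f := fun y ↦ min 1 (π y / π x) * scaledProp d q φ s (x - y))
      (g := fun y ↦ (Metric.closedBall 0 r).indicator (scaledProp d q φ s) (x - y))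
      (fun z hz ↦ ?_) (fun z _ ↦ ?_) y
    · rw [indicator_of_mem (by simpa [← dist_eq_norm] using hr z hz)]
      exact mul_le_of_le_one_left (scaledProp_nonneg hq_nonneg hs _) (min_le_left _ _)
    · exact indicator_nonneg (fun w _ ↦ scaledProp_nonneg hq_nonneg hs w) _

end ScaledProposal

/-- If `π` has compact support, then for every `α* > 0` there is a level `a` such that
the expected acceptance rate satisfies `acc(x,s) ≤ α*/2` for all `x` in the support and
all `s ≥ a`. -/
theorem acc_upper_bound_compact_support {d : ℕ} (hd : 1 ≤ d)
    (π q : EuclideanSpace ℝ (Fin d) → ℝ)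
    (hπ_meas : Measurable π) (hπ_nonneg : ∀ x, 0 ≤ π x) (hπ_int : ∫ x, π x = 1)
    (hπ_supp : IsCompact {z | 0 < π z})
    (hq_meas : Measurable q) (hq_nonneg : ∀ z, 0 ≤ q z) (hq_int : ∫ z, q z = 1)
    (φ : ℝ → ℝ) (hφ_mono : StrictMono φ) (hφ_pos : ∀ s, 0 < φ s)
    (hφ_surj : ∀ t : ℝ, 0 < t → ∃ s, φ s = t)
    (αstar : ℝ) (hαstar : 0 < αstar) :
    ∃ a : ℝ, ∀ x ∈ {z | 0 < π z}, ∀ s : ℝ, a ≤ s →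
      accRate d π q φ x s ≤ αstar / 2 := by
  have : Nonempty (Fin d) := ⟨⟨0, hd⟩⟩
  have hq : Integrable q := .of_integral_ne_zero (by rw [hq_int]; exact one_ne_zero)
  obtain ⟨δ, hδ, hδ_le⟩ := exists_pos_setIntegral_closedBall_le hq 0 (half_pos hαstar)
  obtain ⟨C, hC⟩ := Metric.isBounded_iff.1 hπ_supp.isBounded
  have hr : 0 < max C 1 := lt_max_of_lt_right one_pos
  obtain ⟨a, ha⟩ := hφ_surj (max C 1 / δ) (div_pos hr hδ)
  refine ⟨a, fun x hx s hs ↦ ?_⟩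
  have hdiv : max C 1 / φ s ≤ δ := by
    rw [div_le_comm₀ (hφ_pos s) hδ, ← ha]
    exact hφ_mono.monotone hs
  calc accRate d π q φ x s
      ≤ ∫ z in Metric.closedBall 0 (max C 1 / φ s), q z :=
        accRate_le_setIntegral_closedBall hπ_meas hπ_nonneg hq hq_nonneg (hφ_pos s)
          fun y hy ↦ (hC hx hy).trans (le_max_left _ _)
    _ ≤ ∫ z in Metric.closedBall 0 δ, q z :=
        setIntegral_mono_set hq.integrableOn (.of_forall hq_nonneg)
          (Metric.closedBall_subset_closedBall hdiv).eventuallyLE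
    _ ≤ αstar / 2 := hδ_le
end

section
/- Let κ > 0 and let 𝒫 be a set of symmetric positive definite d×d matrices all of whose eigenvalues are at least κ. Let q̂ : [0,∞) → (0,∞) be bounded, decreasing and differentiable with ∫₀^∞ u^{d−1} q̂(u) du < ∞, and for s ∈ 𝒫 define q_s(z) := det(s)^{−1} q̂(‖s^{−1}z‖), each q_s being a probability density on ℝ^d. Then there exists a constant c₁ < ∞, depending only on d, κ and q̂, such that for all s, s' ∈ 𝒫: ∫_{ℝ^d} |q_s(x) − q_{s'}(x)| dx ≤ c₁ max{‖s‖_F, ‖s'‖_F}^{d+1} ‖s − s'‖_F, where ‖·‖_F denotes the Frobenius norm ‖a‖_F := √(tr(aᵀa)). -/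
open MeasureTheory Set

/-- The elliptically symmetric proposal density
`q_s(z) = det(s)⁻¹ q̂(‖s⁻¹ z‖)` for a matrix scaling parameter `s`. -/
noncomputable def ellipticProp {d : ℕ} (qhat : ℝ → ℝ) (s : Matrix (Fin d) (Fin d) ℝ)
    (z : EuclideanSpace ℝ (Fin d)) : ℝ :=
  (s.det)⁻¹ * qhat ‖(EuclideanSpace.equiv (Fin d) ℝ).symm
    (s⁻¹.mulVec (EuclideanSpace.equiv (Fin d) ℝ z))‖

/-- The Frobenius norm of a real matrix, `‖a‖_F = √(tr(aᵀ a)) = √(∑ᵢⱼ aᵢⱼ²)`. -/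
noncomputable def frobeniusNorm' {d : ℕ} (A : Matrix (Fin d) (Fin d) ℝ) : ℝ :=
  Real.sqrt (∑ i, ∑ j, (A i j) ^ 2)

/-- A Hermitian matrix with spectrum bounded below by `κ` expands norms by at least `κ`. -/
lemma mul_norm_le_norm_toLp_mulVec {ι : Type*} [Fintype ι] [DecidableEq ι] {κ : ℝ}
    {s : Matrix ι ι ℝ} (hs : s.IsHermitian) (h : ∀ μ ∈ spectrum ℝ s, κ ≤ μ)
    (u : EuclideanSpace ℝ ι) :
    κ * ‖u‖ ≤ ‖WithLp.toLp 2 (s.mulVec u.ofLp)‖ := by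
  have hpsd : (s - algebraMap ℝ (Matrix ι ι ℝ) κ).PosSemidef := by
    open scoped MatrixOrder in
    exact Matrix.le_iff.mp ((algebraMap_le_iff_le_spectrum (a := s) hs.isSelfAdjoint).2 h)
  have hquad := hpsd.dotProduct_mulVec_nonneg u.ofLp
  have hinner : κ * ‖u‖ ^ 2 ≤ inner ℝ u (WithLp.toLp 2 (s.mulVec u.ofLp)) := by
    rw [← real_inner_self_eq_norm_sq]
    simp only [EuclideanSpace.inner_eq_star_dotProduct]
    simp only [Matrix.sub_mulVec, Algebra.algebraMap_eq_smul_one, Matrix.smul_mulVec,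
      Matrix.one_mulVec, dotProduct_sub, dotProduct_smul, smul_eq_mul, star_trivial] at hquad ⊢
    rw [dotProduct_comm (s.mulVec _)]
    linarith
  have hcs := real_inner_le_norm u (WithLp.toLp 2 (s.mulVec u.ofLp))
  rcases (norm_nonneg u).eq_or_lt with hu | hu
  · simp [← hu]
  · nlinarith

/-- The Euclidean operator norm is bounded by the Frobenius norm. -/
lemma norm_toLp_mulVec_le {d : ℕ} (A : Matrix (Fin d) (Fin d) ℝ)
    (u : EuclideanSpace ℝ (Fin d)) :
    ‖WithLp.toLp 2 (A.mulVec u.ofLp)‖ ≤ frobeniusNorm' A * ‖u‖ := by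
  rw [EuclideanSpace.norm_eq, EuclideanSpace.norm_eq, frobeniusNorm',
    ← Real.sqrt_mul (by positivity)]
  apply Real.sqrt_le_sqrt
  rw [Finset.sum_mul]
  refine Finset.sum_le_sum fun i _ => ?_
  simp only [Real.norm_eq_abs, sq_abs, Matrix.mulVec, dotProduct]
  exact Finset.sum_mul_sq_le_sq_mul_sq _ _ _

lemma frobeniusNorm'_sub_comm {d : ℕ} (A B : Matrix (Fin d) (Fin d) ℝ) :
    frobeniusNorm' (A - B) = frobeniusNorm' (B - A) := by
  simp only [frobeniusNorm', Matrix.sub_apply]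
  congr 1
  exact Finset.sum_congr rfl fun i _ => Finset.sum_congr rfl fun j _ => by ring

lemma le_frobeniusNorm' {d : ℕ} (hd : 1 ≤ d) {κ : ℝ} {s : Matrix (Fin d) (Fin d) ℝ}
    (hs : s.IsHermitian) (h : ∀ μ ∈ spectrum ℝ s, κ ≤ μ) : κ ≤ frobeniusNorm' s := by
  have hlow := mul_norm_le_norm_toLp_mulVec hs h (EuclideanSpace.single ⟨0, hd⟩ 1)
  have hup := norm_toLp_mulVec_le s (EuclideanSpace.single ⟨0, hd⟩ 1)
  simp only [PiLp.norm_single, norm_one, mul_one] at hlow hup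
  exact hlow.trans hup

lemma norm_toLp_inv_mulVec_le {d : ℕ} {κ : ℝ} (hκ : 0 < κ) {s s' : Matrix (Fin d) (Fin d) ℝ}
    (hs : s.PosDef) (hs' : s'.PosDef) (h' : ∀ μ ∈ spectrum ℝ s', κ ≤ μ)
    (z : EuclideanSpace ℝ (Fin d)) :
    ‖WithLp.toLp 2 (s'⁻¹.mulVec z.ofLp)‖ ≤
      (1 + frobeniusNorm' (s - s') / κ) * ‖WithLp.toLp 2 (s⁻¹.mulVec z.ofLp)‖ := by
  have hu : IsUnit s.det := (Matrix.isUnit_iff_isUnit_det s).1 hs.isUnit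
  have hu' : IsUnit s'.det := (Matrix.isUnit_iff_isUnit_det s').1 hs'.isUnit
  set w := WithLp.toLp 2 (s⁻¹.mulVec z.ofLp) with hw
  set v := WithLp.toLp 2 (s'⁻¹.mulVec z.ofLp) with hv
  have hdiff : s'.mulVec (v - w).ofLp = (s - s').mulVec w.ofLp := by
    simp [hw, hv, Matrix.mulVec_sub, Matrix.mulVec_mulVec, Matrix.sub_mul, Matrix.sub_mulVec,
      Matrix.mul_nonsing_inv _ hu, Matrix.mul_nonsing_inv _ hu']
  have hlow := mul_norm_le_norm_toLp_mulVec hs'.isHermitian h' (v - w)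
  rw [hdiff] at hlow
  have hvw : ‖v - w‖ ≤ frobeniusNorm' (s - s') / κ * ‖w‖ := by
    rw [div_mul_eq_mul_div, le_div_iff₀ hκ, mul_comm]
    exact hlow.trans (norm_toLp_mulVec_le _ _)
  have htri := norm_le_norm_add_norm_sub' v w
  linarith

/-- If `f` dilated by `r ≥ 1` is a common minorant of the probability densities `f` and `g`,
then `f` and `g` are close in total variation. -/
lemma integral_abs_sub_le_of_dilation_le {E : Type*} [NormedAddCommGroup E] [NormedSpace ℝ E]
    [FiniteDimensional ℝ E] [MeasurableSpace E] [BorelSpace E] {μ : Measure E}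
    [μ.IsAddHaarMeasure] {f g : E → ℝ} (hf : ∫ z, f z ∂μ = 1) (hg : ∫ z, g z ∂μ = 1)
    {r : ℝ} (hr : 1 ≤ r) (hrf : ∀ z, f (r • z) ≤ f z) (hrg : ∀ z, f (r • z) ≤ g z) :
    ∫ z, |f z - g z| ∂μ ≤ 2 * Module.finrank ℝ E * (r - 1) := by
  have hr0 : 0 < r := by linarith
  have hfi : Integrable f μ := .of_integral_ne_zero (by simp [hf])
  have hgi : Integrable g μ := .of_integral_ne_zero (by simp [hg])
  have hfr : Integrable (fun z => f (r • z)) μ := hfi.comp_smul hr0.ne'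
  have hint : ∫ z, f (r • z) ∂μ = (r⁻¹) ^ Module.finrank ℝ E := by
    rw [Measure.integral_comp_smul, hf, abs_of_pos (by positivity), smul_eq_mul, mul_one, inv_pow]
  have hbern : 1 - Module.finrank ℝ E * (r - 1) ≤ (r⁻¹) ^ Module.finrank ℝ E := by
    have hrinv : 0 < r⁻¹ := by positivity
    have hmul : r * r⁻¹ = 1 := mul_inv_cancel₀ hr0.ne'
    have hone := one_add_mul_le_pow (a := r⁻¹ - 1) (by linarith) (Module.finrank ℝ E)
    rw [add_sub_cancel] at hone
    refine le_trans ?_ hone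
    have : 1 - r ≤ r⁻¹ - 1 := by nlinarith [sq_nonneg (r - 1)]
    nlinarith [mul_le_mul_of_nonneg_left this (Nat.cast_nonneg (α := ℝ) (Module.finrank ℝ E))]
  calc ∫ z, |f z - g z| ∂μ
      ≤ ∫ z, (f z + g z - 2 * f (r • z)) ∂μ := by
        refine integral_mono (hfi.sub hgi).abs ((hfi.add hgi).sub (hfr.const_mul 2)) fun z => ?_
        rw [abs_le]
        constructor <;> linarith [hrf z, hrg z]
    _ = 2 - 2 * (r⁻¹) ^ Module.finrank ℝ E := by
        rw [integral_sub (by exact hfi.add hgi) (hfr.const_mul 2), integral_add hfi hgi,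
          integral_const_mul, hf, hg, hint]
        norm_num
    _ ≤ 2 * Module.finrank ℝ E * (r - 1) := by linarith

lemma ellipticProp_smul {d : ℕ} (qhat : ℝ → ℝ) (s : Matrix (Fin d) (Fin d) ℝ) {r : ℝ}
    (hr : 0 ≤ r) (z : EuclideanSpace ℝ (Fin d)) :
    ellipticProp qhat s (r • z) =
      s.det⁻¹ * qhat (r * ‖WithLp.toLp 2 (s⁻¹.mulVec z.ofLp)‖) := by
  have h : (EuclideanSpace.equiv (Fin d) ℝ).symm
      (s⁻¹.mulVec (EuclideanSpace.equiv (Fin d) ℝ (r • z))) =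
        r • WithLp.toLp 2 (s⁻¹.mulVec z.ofLp) := by
    rw [map_smul, Matrix.mulVec_smul, map_smul]
    rfl
  rw [ellipticProp, h, norm_smul, Real.norm_of_nonneg hr]

lemma integral_abs_ellipticProp_sub_le {d : ℕ} {κ : ℝ} (hκ : 0 < κ) {qhat : ℝ → ℝ}
    (hpos : ∀ x : ℝ, 0 ≤ x → 0 < qhat x)
    (hanti : ∀ x y : ℝ, 0 ≤ x → x ≤ y → qhat y ≤ qhat x)
    {s s' : Matrix (Fin d) (Fin d) ℝ} (hs : s.PosDef) (hs' : s'.PosDef)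
    (h' : ∀ μ ∈ spectrum ℝ s', κ ≤ μ)
    (hint : ∫ z, ellipticProp qhat s z = 1) (hint' : ∫ z, ellipticProp qhat s' z = 1)
    (hdet : s'.det ≤ s.det) :
    ∫ z, |ellipticProp qhat s z - ellipticProp qhat s' z| ≤
      2 * d / κ * frobeniusNorm' (s - s') := by
  have hδ : 0 ≤ frobeniusNorm' (s - s') / κ := div_nonneg (Real.sqrt_nonneg _) hκ.le
  have hr : 1 ≤ 1 + frobeniusNorm' (s - s') / κ := by linarith
  have hr0 : 0 ≤ 1 + frobeniusNorm' (s - s') / κ := by linarith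
  refine (integral_abs_sub_le_of_dilation_le hint hint' hr (fun z => ?_) fun z => ?_).trans_eq ?_
  · rw [ellipticProp_smul _ _ hr0]
    exact mul_le_mul_of_nonneg_left
      (hanti _ _ (norm_nonneg _) (le_mul_of_one_le_left (norm_nonneg _) hr))
      (inv_nonneg.2 hs.det_pos.le)
  · rw [ellipticProp_smul _ _ hr0]
    exact mul_le_mul (inv_anti₀ hs'.det_pos hdet)
      (hanti _ _ (norm_nonneg _) (norm_toLp_inv_mulVec_le hκ hs hs' h' z))
      (hpos _ (by positivity)).le (inv_nonneg.2 hs'.det_pos.le)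
  · rw [finrank_euclideanSpace_fin]
    ring

/-- Total-variation estimate between elliptically symmetric proposal densities:
`∫ |q_s − q_{s'}| ≤ c₁ max{‖s‖_F, ‖s'‖_F}^{d+1} ‖s − s'‖_F`, where the constant `c₁`
depends only on `d`, the eigenvalue lower bound `κ` and the radial profile `q̂`. -/
theorem elliptic_proposal_total_variation {d : ℕ} (hd : 1 ≤ d)
    (κ : ℝ) (hκ : 0 < κ)
    (qhat : ℝ → ℝ)
    (hqhat_meas : Measurable qhat)
    (hqhat_pos : ∀ x : ℝ, 0 ≤ x → 0 < qhat x)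
    (hqhat_bdd : ∃ C : ℝ, ∀ x : ℝ, 0 ≤ x → qhat x ≤ C)
    (hqhat_anti : ∀ x y : ℝ, 0 ≤ x → x ≤ y → qhat y ≤ qhat x)
    (hqhat_diff : ∀ x : ℝ, 0 ≤ x → DifferentiableAt ℝ qhat x)
    (hqhat_int : IntegrableOn (fun u : ℝ => u ^ (d - 1) * qhat u) (Set.Ioi (0 : ℝ)))
    (hdens : ∀ s : Matrix (Fin d) (Fin d) ℝ, s.PosDef →
      (∀ μ ∈ spectrum ℝ s, κ ≤ μ) → ∫ z, ellipticProp qhat s z = 1) :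
    ∃ c₁ : ℝ, 0 < c₁ ∧
      ∀ s s' : Matrix (Fin d) (Fin d) ℝ,
        s.PosDef → (∀ μ ∈ spectrum ℝ s, κ ≤ μ) →
        s'.PosDef → (∀ μ ∈ spectrum ℝ s', κ ≤ μ) →
        (∫ z, |ellipticProp qhat s z - ellipticProp qhat s' z|)
          ≤ c₁ * max (frobeniusNorm' s) (frobeniusNorm' s') ^ (d + 1)
              * frobeniusNorm' (s - s') := by
  have hd0 : (0 : ℝ) < d := by exact_mod_cast hd
  refine ⟨2 * d / κ / κ ^ (d + 1), by positivity, fun s s' hs h hs' h' => ?_⟩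
  have hbound : ∫ z, |ellipticProp qhat s z - ellipticProp qhat s' z| ≤
      2 * d / κ * frobeniusNorm' (s - s') := by
    rcases le_total s'.det s.det with hdet | hdet
    · exact integral_abs_ellipticProp_sub_le hκ hqhat_pos hqhat_anti hs hs' h'
        (hdens s hs h) (hdens s' hs' h') hdet
    · simp_rw [abs_sub_comm (ellipticProp qhat s _), frobeniusNorm'_sub_comm s s']
      exact integral_abs_ellipticProp_sub_le hκ hqhat_pos hqhat_anti hs' hs h
        (hdens s' hs' h') (hdens s hs h) hdet
  refine hbound.trans (mul_le_mul_of_nonneg_right ?_ (Real.sqrt_nonneg _))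
  rw [div_mul_eq_mul_div, le_div_iff₀ (by positivity)]
  have hκmax : κ ≤ max (frobeniusNorm' s) (frobeniusNorm' s') :=
    le_max_of_le_left (le_frobeniusNorm' hd hs.isHermitian h)
  gcongr
end

section
/- Let d ≥ 1 and define q̂ : [0,∞) → (0,∞) by q̂(x) := e^{−x²/2}. Then there exist ε* > 0, constants 0 ≤ a < b < ∞ and c₁, c₂, c₃ > 0 such that for every 0 ≤ ε ≤ ε*: q̂'(x) − 2q̂'(x+ε) ≥ c₁ for all a ≤ x ≤ b, and ∫₀^∞ min{0, q̂'(x) − 2q̂'(x+ε)} dx ≥ −c₂ e^{−c₃/ε}. -/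
open MeasureTheory Set

theorem deriv_exp_neg_sq_div_two (x : ℝ) :
    deriv (fun t : ℝ => Real.exp (-t ^ 2 / 2)) x = -(x * Real.exp (-x ^ 2 / 2)) := by
  have h : HasDerivAt (fun t : ℝ => -t ^ 2 / 2) (-x) x := by
    refine ((hasDerivAt_pow 2 x).fun_neg.div_const 2).congr_deriv ?_
    norm_num
    ring
  rw [h.exp.deriv]
  ring

/-- On the range `x ε ≤ 1 / 4`, a shift by `ε` changes the Gaussian only by a bounded factor. -/
theorem mul_exp_neg_sq_le_shift {x ε : ℝ} (hx : 0 ≤ x) (hε : 0 ≤ ε) (hε' : ε ≤ 1 / 8)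
    (hxε : x * ε ≤ 1 / 4) :
    x * Real.exp (-x ^ 2 / 2) * (2 / 5) ≤
      -(x * Real.exp (-x ^ 2 / 2)) + 2 * ((x + ε) * Real.exp (-(x + ε) ^ 2 / 2)) := by
  have hsplit : Real.exp (-(x + ε) ^ 2 / 2) =
      Real.exp (-x ^ 2 / 2) * Real.exp (-(x * ε + ε ^ 2 / 2)) := by
    rw [← Real.exp_add]
    congr 1
    ring
  have hfac : 7 / 10 ≤ Real.exp (-(x * ε + ε ^ 2 / 2)) := by
    have := Real.add_one_le_exp (-(x * ε + ε ^ 2 / 2))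
    nlinarith
  have hprod : x * (7 / 10) ≤ (x + ε) * Real.exp (-(x * ε + ε ^ 2 / 2)) :=
    mul_le_mul (by linarith) hfac (by norm_num) (by linarith)
  have := mul_le_mul_of_nonneg_left hprod (Real.exp_pos (-x ^ 2 / 2)).le
  rw [hsplit]
  linarith

theorem neg_min_zero_shift_le {x ε : ℝ} (hx : 0 ≤ x) (hε : 0 ≤ ε) (hε' : ε ≤ 1 / 8) :
    -min 0 (-(x * Real.exp (-x ^ 2 / 2)) + 2 * ((x + ε) * Real.exp (-(x + ε) ^ 2 / 2))) ≤
      Real.exp (-(1 / 8) / ε) * (x * Real.exp (-(1 / 4) * x ^ 2)) := by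
  rw [neg_le, le_min_iff]
  refine ⟨neg_nonpos.2 (by positivity), ?_⟩
  rcases le_or_gt (x * ε) (1 / 4) with h | h
  · have h₁ := mul_exp_neg_sq_le_shift hx hε hε' h
    have h₂ : 0 ≤ x * Real.exp (-x ^ 2 / 2) * (2 / 5) := by positivity
    have h₃ : 0 ≤ Real.exp (-(1 / 8) / ε) * (x * Real.exp (-(1 / 4) * x ^ 2)) := by positivity
    linarith
  · have hpos : 0 < ε := by
      rcases hε.eq_or_lt with rfl | h'
      · norm_num at h
      · exact h'
    have hexp : 1 / 8 / ε ≤ x ^ 2 / 4 := by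
      rw [div_le_iff₀ hpos]
      have hx2 : 2 ≤ x := by nlinarith
      nlinarith
    have h₁ : Real.exp (-x ^ 2 / 2) ≤
        Real.exp (-(1 / 8) / ε) * Real.exp (-(1 / 4) * x ^ 2) := by
      rw [← Real.exp_add, Real.exp_le_exp, neg_div ε (1 / 8)]
      linarith
    have h₂ := mul_le_mul_of_nonneg_left h₁ hx
    have h₃ : 0 ≤ (x + ε) * Real.exp (-(x + ε) ^ 2 / 2) := by positivity
    linarith

/-- The Gaussian radial profile `q̂(x) = e^{−x²/2}` satisfies the derivative
conditions required of the template proposal density: for all small `ε ≥ 0`,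
`q̂'(x) − 2q̂'(x+ε) ≥ c₁` on an interval `[a,b]`, and the negative part of
`q̂'(x) − 2q̂'(x+ε)` has integral at least `−c₂ e^{−c₃/ε}`. -/
theorem gaussian_template_satisfies_assumption (d : ℕ) (hd : 1 ≤ d) :
    ∃ εstar : ℝ, 0 < εstar ∧ ∃ a b : ℝ, 0 ≤ a ∧ a < b ∧
    ∃ c₁ c₂ c₃ : ℝ, 0 < c₁ ∧ 0 < c₂ ∧ 0 < c₃ ∧
      ∀ ε : ℝ, 0 ≤ ε → ε ≤ εstar →
        (∀ x : ℝ, a ≤ x → x ≤ b →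
          c₁ ≤ deriv (fun t : ℝ => Real.exp (-t ^ 2 / 2)) x
            - 2 * deriv (fun t : ℝ => Real.exp (-t ^ 2 / 2)) (x + ε)) ∧
        -(c₂ * Real.exp (-c₃ / ε)) ≤
          ∫ x in Set.Ioi (0 : ℝ),
            min 0 (deriv (fun t : ℝ => Real.exp (-t ^ 2 / 2)) x
              - 2 * deriv (fun t : ℝ => Real.exp (-t ^ 2 / 2)) (x + ε)) := by
  have hint : IntegrableOn (fun x : ℝ => x * Real.exp (-(1 / 4) * x ^ 2)) (Ioi 0) :=
    (integrable_mul_exp_neg_mul_sq (by norm_num)).integrableOn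
  have hK : 0 ≤ ∫ x in Ioi (0 : ℝ), x * Real.exp (-(1 / 4) * x ^ 2) :=
    setIntegral_nonneg measurableSet_Ioi fun x hx => mul_nonneg (le_of_lt hx) (Real.exp_pos _).le
  refine ⟨1 / 8, by norm_num, 1, 2, by norm_num, by norm_num, Real.exp (-2) * (2 / 5),
    (∫ x in Ioi (0 : ℝ), x * Real.exp (-(1 / 4) * x ^ 2)) + 1, 1 / 8,
    by positivity, by linarith, by norm_num, fun ε hε hε' => ?_⟩
  simp only [deriv_exp_neg_sq_div_two, mul_neg, sub_neg_eq_add]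
  refine ⟨fun x hx hx' => ?_, ?_⟩
  · refine le_trans ?_ (mul_exp_neg_sq_le_shift (by linarith) hε hε' (by nlinarith))
    have h₁ : Real.exp (-2) ≤ Real.exp (-x ^ 2 / 2) := Real.exp_le_exp.2 (by nlinarith)
    nlinarith [Real.exp_pos (-x ^ 2 / 2)]
  · rw [neg_le, ← integral_neg]
    calc
      _ ≤ ∫ x in Ioi (0 : ℝ),
          Real.exp (-(1 / 8) / ε) * (x * Real.exp (-(1 / 4) * x ^ 2)) := by
        refine integral_mono_of_nonneg (ae_of_all _ fun x => neg_nonneg.2 (min_le_left _ _))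
          (hint.const_mul _) ?_
        filter_upwards [ae_restrict_mem measurableSet_Ioi] with x hx
        exact neg_min_zero_shift_le (le_of_lt hx) hε hε'
      _ ≤ _ := by
        rw [integral_const_mul]
        nlinarith [Real.exp_pos (-(1 / 8) / ε)]
end

section
/- Let d ≥ 1, γ > 0 and define q̂ : [0,∞) → (0,∞) by q̂(x) := (1 + x²)^{−d/2−γ}. Then there exists ε* > 0 such that for every ε ∈ (0, ε*] and every x > 0 one has q̂'(x) − 2q̂'(x+ε) > 0; consequently there exist 0 ≤ a < b < ∞ and constants c₁, c₂, c₃ > 0 such that for every 0 ≤ ε ≤ ε*: q̂'(x) − 2q̂'(x+ε) ≥ c₁ for all a ≤ x ≤ b, and ∫₀^∞ min{0, q̂'(x) − 2q̂'(x+ε)} dx ≥ −c₂ e^{−c₃/ε}. -/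
open MeasureTheory Set

lemma hasDerivAt_one_add_sq_rpow (p x : ℝ) :
    HasDerivAt (fun t : ℝ => (1 + t ^ 2) ^ p) (2 * p * x * (1 + x ^ 2) ^ (p - 1)) x := by
  have h : HasDerivAt (fun t : ℝ => 1 + t ^ 2) (2 * x) x := by
    simpa using (hasDerivAt_pow 2 x).const_add 1
  convert h.rpow_const (p := p) (Or.inl (by positivity)) using 1
  ring

lemma one_add_sq_shift_le_mul_exp {ε : ℝ} (hε : 0 ≤ ε) (hε1 : ε ≤ 1) (x : ℝ) :
    1 + (x + ε) ^ 2 ≤ (1 + x ^ 2) * Real.exp (2 * ε) := by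
  calc 1 + (x + ε) ^ 2 ≤ (1 + x ^ 2) * (2 * ε + 1) := by
        nlinarith [mul_nonneg hε (sq_nonneg (2 * x - 1)), mul_nonneg hε (sub_nonneg.2 hε1)]
    _ ≤ (1 + x ^ 2) * Real.exp (2 * ε) := by
        gcongr
        exact Real.add_one_le_exp _

lemma one_add_sq_rpow_mul_exp_le_shift {s ε : ℝ} (hs : s ≤ -1) (hε : 0 ≤ ε)
    (hεs : ε * (4 * -s) ≤ 1) (x : ℝ) :
    (1 + x ^ 2) ^ s * Real.exp (-1 / 2) ≤ (1 + (x + ε) ^ 2) ^ s := by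
  have hε1 : ε ≤ 1 := by nlinarith
  calc (1 + x ^ 2) ^ s * Real.exp (-1 / 2)
      ≤ (1 + x ^ 2) ^ s * Real.exp (2 * ε * s) := by
        gcongr
        linarith
    _ = ((1 + x ^ 2) * Real.exp (2 * ε)) ^ s := by
        rw [Real.mul_rpow (by positivity) (by positivity), ← Real.exp_mul]
    _ ≤ (1 + (x + ε) ^ 2) ^ s :=
        Real.rpow_le_rpow_of_nonpos (by positivity) (one_add_sq_shift_le_mul_exp hε hε1 x)
          (by linarith)

lemma le_deriv_one_add_sq_rpow_sub_two_mul_shift {p ε x : ℝ} (hp : p < 0) (hε : 0 ≤ ε)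
    (hεp : ε * (4 * (1 - p)) ≤ 1) (hx : 0 ≤ x) :
    -2 * p * (2 * Real.exp (-1 / 2) - 1) * (x * (1 + x ^ 2) ^ (p - 1)) ≤
      deriv (fun t : ℝ => (1 + t ^ 2) ^ p) x
        - 2 * deriv (fun t : ℝ => (1 + t ^ 2) ^ p) (x + ε) := by
  rw [(hasDerivAt_one_add_sq_rpow p x).deriv, (hasDerivAt_one_add_sq_rpow p (x + ε)).deriv]
  have h := one_add_sq_rpow_mul_exp_le_shift (s := p - 1) (by linarith) hε (by linarith) x
  have h' : x * ((1 + x ^ 2) ^ (p - 1) * Real.exp (-1 / 2)) ≤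
      (x + ε) * (1 + (x + ε) ^ 2) ^ (p - 1) := by
    gcongr
    linarith
  nlinarith [mul_le_mul_of_nonneg_left h' (by linarith : 0 ≤ -4 * p)]

/-- The Student radial profile `q̂(x) = (1+x²)^{−d/2−γ}` satisfies the derivative
conditions required of the template proposal density: for all small `ε > 0`,
`q̂'(x) − 2q̂'(x+ε) > 0` for all `x > 0`; consequently, for all small `ε ≥ 0`,
`q̂'(x) − 2q̂'(x+ε) ≥ c₁` on an interval `[a,b]`, and the negative part of
`q̂'(x) − 2q̂'(x+ε)` has integral at least `−c₂ e^{−c₃/ε}`. -/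
theorem student_template_satisfies_assumption (d : ℕ) (hd : 1 ≤ d) (γ : ℝ) (hγ : 0 < γ) :
    ∃ εstar : ℝ, 0 < εstar ∧
      (∀ ε : ℝ, 0 < ε → ε ≤ εstar → ∀ x : ℝ, 0 < x →
        0 < deriv (fun t : ℝ => (1 + t ^ 2) ^ (-(d : ℝ) / 2 - γ)) x
          - 2 * deriv (fun t : ℝ => (1 + t ^ 2) ^ (-(d : ℝ) / 2 - γ)) (x + ε)) ∧
      (∃ a b : ℝ, 0 ≤ a ∧ a < b ∧
        ∃ c₁ c₂ c₃ : ℝ, 0 < c₁ ∧ 0 < c₂ ∧ 0 < c₃ ∧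
          ∀ ε : ℝ, 0 ≤ ε → ε ≤ εstar →
            (∀ x : ℝ, a ≤ x → x ≤ b →
              c₁ ≤ deriv (fun t : ℝ => (1 + t ^ 2) ^ (-(d : ℝ) / 2 - γ)) x
                - 2 * deriv (fun t : ℝ => (1 + t ^ 2) ^ (-(d : ℝ) / 2 - γ)) (x + ε)) ∧
            -(c₂ * Real.exp (-c₃ / ε)) ≤
              ∫ x in Set.Ioi (0 : ℝ),
                min 0 (deriv (fun t : ℝ => (1 + t ^ 2) ^ (-(d : ℝ) / 2 - γ)) x
                  - 2 * deriv (fun t : ℝ => (1 + t ^ 2) ^ (-(d : ℝ) / 2 - γ)) (x + ε))) := by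
  have hp : -(d : ℝ) / 2 - γ < 0 := by
    have : (0 : ℝ) ≤ d := d.cast_nonneg
    linarith
  generalize -(d : ℝ) / 2 - γ = p at hp ⊢
  have hk : 0 < -2 * p * (2 * Real.exp (-1 / 2) - 1) := by
    have := Real.add_one_lt_exp (x := -1 / 2) (by norm_num)
    exact mul_pos (by linarith) (by linarith)
  have hq : 0 < 4 * (1 - p) := by linarith
  have key : ∀ ε : ℝ, 0 ≤ ε → ε ≤ 1 / (4 * (1 - p)) → ∀ x : ℝ, 0 ≤ x →
      -2 * p * (2 * Real.exp (-1 / 2) - 1) * (x * (1 + x ^ 2) ^ (p - 1)) ≤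
        deriv (fun t : ℝ => (1 + t ^ 2) ^ p) x
          - 2 * deriv (fun t : ℝ => (1 + t ^ 2) ^ p) (x + ε) := fun ε hε hle x hx =>
    le_deriv_one_add_sq_rpow_sub_two_mul_shift hp hε ((le_div_iff₀ hq).1 hle) hx
  refine ⟨1 / (4 * (1 - p)), by positivity, fun ε hε hle x hx =>
    lt_of_lt_of_le (by positivity) (key ε hε.le hle x hx.le), 1, 2, by norm_num, by norm_num,
    -2 * p * (2 * Real.exp (-1 / 2) - 1) * (1 * (1 + 2 ^ 2) ^ (p - 1)), 1, 1, by positivity,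
    one_pos, one_pos, fun ε hε hle => ⟨fun x hx1 hx2 => ?_, ?_⟩⟩
  · refine le_trans ?_ (key ε hε hle x (by linarith))
    have h : (1 + 2 ^ 2 : ℝ) ^ (p - 1) ≤ (1 + x ^ 2) ^ (p - 1) :=
      Real.rpow_le_rpow_of_nonpos (by positivity) (by gcongr) (by linarith)
    gcongr
  · rw [setIntegral_eq_zero_of_forall_eq_zero]
    · simp only [one_mul, Left.neg_nonpos_iff]
      positivity
    · intro x hx
      have hx : 0 < x := hx
      exact min_eq_left (le_trans (by positivity) (key ε hε hle x hx.le))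
end
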